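/- Let G be a finite group, m a positive integer, and g ∈ G. For each irreducible complex character χ of G set r_χ = (1/|G|) · ∑_{x ∈ G, x^m = 1} χ(x). Then each r_χ is a real number, and the number of elements x ∈ G satisfying x^m = 1 and (g·x)^m = 1 equals |G| · ∑_{χ ∈ Irr(G)} (r_χ² / χ(1)) · χ(g). -/

import Mathlib

open CategoryTheory

open scoped ComplexOrder in
/-- The character at an inverse is the complex conjugate. -/
theorem aux_char_inv {G : Type} [Group G] [Fintype G] (V : FDRep ℂ G) (h : G) :
    V.character h⁻¹ = star (V.character h) := by
  classical
  let b := Module.finBasis ℂ V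
  let A : G → Matrix _ _ ℂ := fun x => LinearMap.toMatrix b b (V.ρ x)
  have hmul : ∀ x y, A (x * y) = A x * A y := fun x y => by
    simp only [A, map_mul]
    exact LinearMap.toMatrix_mul b _ _
  have hone : A 1 = 1 := by
    simp only [A, map_one]
    exact LinearMap.toMatrix_one b
  have htr : ∀ x, V.character x = (A x).trace := fun x =>
    LinearMap.trace_eq_matrix_trace ℂ b (V.ρ x)
  let P := ∑ x, (A x).conjTranspose * A x
  have hP : P.PosDef := by
    refine Matrix.posDef_sum Finset.univ_nonempty (fun x _ => ?_)
    apply Matrix.PosDef.conjTranspose_mul_self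
    apply Matrix.mulVec_injective_of_isUnit
    exact IsUnit.of_mul_eq_one (A x⁻¹) (by rw [← hmul, mul_inv_cancel, hone])
  have hPA : (A h).conjTranspose * P * A h = P := by
    simp only [P, Finset.mul_sum, Finset.sum_mul]
    refine Fintype.sum_bijective (· * h) (Group.mulRight_bijective h) _ _ fun x => ?_
    simp only [hmul, Matrix.conjTranspose_mul, mul_assoc]
  have hu : IsUnit P := hP.isUnit
  have h2 : (A h).conjTranspose * P = P * A h⁻¹ := by
    calc (A h).conjTranspose * P = (A h).conjTranspose * P * (A h * A h⁻¹) := by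
          rw [← hmul, mul_inv_cancel, hone, mul_one]
      _ = _ := by rw [← mul_assoc, hPA]
  rw [htr, htr, ← Matrix.trace_conjTranspose]
  have h3 : (A h).conjTranspose = P * A h⁻¹ * P⁻¹ := by
    rw [← h2, mul_assoc, Matrix.mul_nonsing_inv _ ((Matrix.isUnit_iff_isUnit_det _).1 hu), mul_one]
  rw [h3, Matrix.trace_conj hu]

/-- Irreducible representations give simple objects. -/
theorem aux_simple {G : Type} [Group G] [Fintype G] {U : Type} [AddCommGroup U] [Module ℂ U]
    [FiniteDimensional ℂ U] (ρ : Representation ℂ G U) [ρ.IsIrreducible] :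
    Simple (FDRep.of ρ) := by
  rw [FDRep.simple_iff_char_is_norm_one]
  have : Invertible (Nat.card G : ℂ) := invertibleOfNonzero (NeZero.ne (Nat.card G : ℂ))
  have h := Representation.char_orthonormal ρ ρ
  rw [if_pos ⟨Representation.Equiv.refl ρ⟩, inv_mul_eq_iff_eq_mul₀ (NeZero.ne _)] at h
  rw [mul_one] at h
  exact h

theorem aux_decomp {G : Type} [Group G] [Fintype G] {ι : Type} [Fintype ι] (V : ι → FDRep ℂ G)
    (hcomplete : ∀ W : FDRep ℂ G, Simple W → ∃ i, Nonempty (W ≅ V i)) (n : ℕ) :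
    ∀ (U : Type) [AddCommGroup U] [Module ℂ U] [FiniteDimensional ℂ U] (ρ : Representation ℂ G U),
      Module.finrank ℂ U = n → ∃ c : ι → ℂ, ∀ g, ρ.character g = ∑ i, c i * (V i).character g := by
  classical
  induction n using Nat.strong_induction_on with
  | _ n ih =>
  intro U _ _ _ ρ hn
  by_cases hirr : ρ.IsIrreducible
  · obtain ⟨i, ⟨e⟩⟩ := hcomplete _ (aux_simple ρ)
    refine ⟨fun j => if j = i then 1 else 0, fun g => ?_⟩
    simp only [ite_mul, one_mul, zero_mul, Finset.sum_ite_eq', Finset.mem_univ, if_true]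
    rw [← FDRep.char_iso e]
    rfl
  rcases subsingleton_or_nontrivial U with hU | hU
  · refine ⟨0, fun g => ?_⟩
    have : ρ g = 0 := Subsingleton.elim _ _
    simp [Representation.character, this]
  have hbt : (⊥ : Subrepresentation ρ) ≠ ⊤ := fun h => by
    have := congrArg Subrepresentation.toSubmodule h
    exact bot_ne_top (α := Submodule ℂ U) this
  obtain ⟨p, hp0, hp1⟩ : ∃ p : Subrepresentation ρ, p ≠ ⊥ ∧ p ≠ ⊤ := by
    by_contra! hcon
    apply hirr
    exact { exists_pair_ne := ⟨⊥, ⊤, hbt⟩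
            eq_bot_or_eq_top := fun p => or_iff_not_imp_left.2 (hcon p) }
  obtain ⟨q, hpq⟩ := exists_isCompl p
  have hc : IsCompl p.toSubmodule q.toSubmodule := by
    rw [isCompl_iff, disjoint_iff, codisjoint_iff]
    exact ⟨congrArg Subrepresentation.toSubmodule hpq.inf_eq_bot,
      congrArg Subrepresentation.toSubmodule hpq.sup_eq_top⟩
  have hp0' : p.toSubmodule ≠ ⊥ := fun h => hp0 (Subrepresentation.toSubmodule_injective h)
  have hp1' : p.toSubmodule ≠ ⊤ := fun h => hp1 (Subrepresentation.toSubmodule_injective h)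
  have hadd := Submodule.finrank_add_eq_of_isCompl hc
  have hlt := Submodule.finrank_lt hp1'
  have hpos : 0 < Module.finrank ℂ p.toSubmodule :=
    Nat.pos_of_ne_zero fun h => hp0' (Submodule.finrank_eq_zero.1 h)
  obtain ⟨c, hcc⟩ := ih _ (by omega) p.toSubmodule p.toRepresentation rfl
  obtain ⟨d, hd⟩ := ih _ (by omega) q.toSubmodule q.toRepresentation rfl
  refine ⟨c + d, fun g => ?_⟩
  simp only [Pi.add_apply, add_mul, Finset.sum_add_distrib, ← hcc, ← hd]
  simp only [Representation.character]
  rw [← LinearMap.trace_prodMap', ← LinearMap.trace_conj' _ (Submodule.prodEquivOfIsCompl _ _ hc)]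
  congr 1
  refine LinearMap.ext fun u => ?_
  obtain ⟨⟨a, b⟩, rfl⟩ := (Submodule.prodEquivOfIsCompl _ _ hc).surjective u
  rw [LinearEquiv.conj_apply_apply, LinearEquiv.symm_apply_apply]
  simp [Submodule.coe_prodEquivOfIsCompl', Subrepresentation.toRepresentation]

/-- The regular representation on functions. -/
noncomputable def auxReg (G : Type) [Group G] : Representation ℂ G (G → ℂ) where
  toFun g := LinearMap.funLeft ℂ ℂ (fun x => x * g)
  map_one' := by ext; simp [LinearMap.funLeft]
  map_mul' a b := by
    refine LinearMap.ext fun f => funext fun x => ?_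
    simp [LinearMap.funLeft, mul_assoc]

theorem aux_regular {G : Type} [Group G] [Fintype G] [DecidableEq G] (g : G) :
    (auxReg G).character g = if g = 1 then (Fintype.card G : ℂ) else 0 := by
  rw [Representation.character, LinearMap.trace_eq_matrix_trace ℂ (Pi.basisFun ℂ G)]
  simp only [Matrix.trace, Matrix.diag_apply, LinearMap.toMatrix_apply, Pi.basisFun_repr,
    Pi.basisFun_apply]
  have : ∀ x : G, auxReg G g (Pi.single x 1) x = if g = 1 then (1 : ℂ) else 0 := by
    intro x
    change (Pi.single x 1 : G → ℂ) (x * g) = _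
    simp [Pi.single_apply]
  simp only [this]
  split_ifs <;> simp

theorem aux_col {G : Type} [Group G] [Fintype G] [DecidableEq G]
    {ι : Type} [Fintype ι] (V : ι → FDRep ℂ G)
    (hsimple : ∀ i, Simple (V i))
    (hdistinct : ∀ i j, i ≠ j → IsEmpty (V i ≅ V j))
    (hcomplete : ∀ W : FDRep ℂ G, Simple W → ∃ i, Nonempty (W ≅ V i)) (g : G) :
    ∑ i, (V i).character 1 * (V i).character g = if g = 1 then (Fintype.card G : ℂ) else 0 := by
  classical
  have : Invertible (Nat.card G : ℂ) := invertibleOfNonzero (NeZero.ne (Nat.card G : ℂ))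
  have hN : (Nat.card G : ℂ) ≠ 0 := NeZero.ne _
  obtain ⟨c, hc⟩ := aux_decomp V hcomplete _ (G → ℂ) (auxReg G) rfl
  have key : ∀ j, c j = (V j).character 1 := by
    intro j
    have h1 : (Nat.card G : ℂ)⁻¹ * ∑ x : G,
        (auxReg G).character x * (V j).character x⁻¹
          = (V j).character 1 := by
      simp only [aux_regular, ite_mul, zero_mul, Finset.sum_ite_eq', Finset.mem_univ, if_true,
        inv_one, ← Nat.card_eq_fintype_card]
      rw [inv_mul_cancel_left₀ hN]
    rw [← h1]
    have h2 : ∀ i, (Nat.card G : ℂ)⁻¹ * ∑ x : G, (V i).character x * (V j).character x⁻¹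
        = if i = j then 1 else 0 := by
      intro i
      have := hsimple i
      have := hsimple j
      rw [FDRep.char_orthonormal]
      by_cases hij : i = j
      · subst hij
        rw [if_pos ⟨Iso.refl _⟩, if_pos rfl]
      · rw [if_neg (not_nonempty_iff.2 (hdistinct i j hij)), if_neg hij]
    have h3 : ∑ i, c i * ((Nat.card G : ℂ)⁻¹ * ∑ x : G, (V i).character x * (V j).character x⁻¹)
        = c j := by
      simp only [h2, mul_ite, mul_one, mul_zero, Finset.sum_ite_eq', Finset.mem_univ, if_true]
    rw [← h3]
    simp only [hc, Finset.mul_sum, Finset.sum_mul]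
    rw [Finset.sum_comm]
    refine Finset.sum_congr rfl fun x _ => Finset.sum_congr rfl fun i _ => by ring
  rw [← aux_regular, hc]
  simp only [key]

/-- Schur. -/
theorem aux_schur {G : Type} [Group G] [Fintype G] (V : FDRep ℂ G) [Simple V]
    (T : V →ₗ[ℂ] V) (hT : ∀ g, V.ρ g * T = T * V.ρ g) :
    V.character 1 ≠ 0 ∧ T = (LinearMap.trace ℂ V T / V.character 1) • (1 : V →ₗ[ℂ] V) := by
  have h1 : Module.finrank ℂ (Representation.invariants (Representation.linHom V.ρ V.ρ)) = 1 := by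
    rw [LinearEquiv.finrank_eq (Representation.linHom.invariantsEquivFDRepHom V V)]
    exact finrank_endomorphism_simple_eq_one ℂ V
  have hmem : ∀ S : V →ₗ[ℂ] V, (∀ g, V.ρ g * S = S * V.ρ g) →
      S ∈ Representation.invariants (Representation.linHom V.ρ V.ρ) := by
    intro S hS g
    change V.ρ g * (S * V.ρ g⁻¹) = S
    rw [← mul_assoc, hS, mul_assoc, ← map_mul, mul_inv_cancel, map_one, mul_one]
  have hne : V.character 1 ≠ 0 := by
    rw [FDRep.char_one]
    intro h
    have h0 : Module.finrank ℂ V = 0 := by exact_mod_cast h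
    have : Subsingleton V := Module.finrank_zero_iff.1 h0
    have hs : Subsingleton (V →ₗ[ℂ] V) := inferInstance
    have : Subsingleton (Representation.invariants (Representation.linHom V.ρ V.ρ)) :=
      ⟨fun a b => Subtype.ext (hs.elim _ _)⟩
    rw [Module.finrank_zero_of_subsingleton] at h1
    exact zero_ne_one h1
  refine ⟨hne, ?_⟩
  have hI : (⟨1, hmem 1 (fun g => by simp)⟩ :
      Representation.invariants (Representation.linHom V.ρ V.ρ)) ≠ 0 := by
    intro h
    have h' : (1 : V →ₗ[ℂ] V) = 0 := congrArg Subtype.val h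
    apply hne
    simp [FDRep.character, h']
  obtain ⟨c, hc⟩ := (finrank_eq_one_iff_of_nonzero' _ hI).1 h1 ⟨T, hmem T hT⟩
  have hc' : c • (1 : V →ₗ[ℂ] V) = T := congrArg Subtype.val hc
  have : LinearMap.trace ℂ V T = c * V.character 1 := by
    rw [← hc', map_smul, smul_eq_mul, FDRep.character, map_one V.ρ]
  rw [this, mul_div_cancel_right₀ _ hne, hc']

/-- Let `G` be a finite group, `m` a positive integer and `g ∈ G`. For
each irreducible complex character `χ` of `G` set `r_χ = (1/|G|) · ∑_{x^m = 1} χ(x)`.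
Then each `r_χ` is real, and the number of `x ∈ G` with `x^m = 1` and `(g·x)^m = 1`
equals `|G| · ∑_χ (r_χ² / χ(1)) · χ(g)`, the sum running over a complete family of
irreducible complex characters of `G`. -/
theorem stmt7 {G : Type} [Group G] [Fintype G] [DecidableEq G]
    (m : ℕ) (hm : 0 < m) (g : G)
    {ι : Type} [Fintype ι] (V : ι → FDRep ℂ G)
    (hsimple : ∀ i, Simple (V i))
    (hdistinct : ∀ i j, i ≠ j → IsEmpty (V i ≅ V j))
    (hcomplete : ∀ W : FDRep ℂ G, Simple W → ∃ i, Nonempty (W ≅ V i))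
    (r : ι → ℂ)
    (hr : ∀ i, r i = (1 / (Fintype.card G : ℂ)) *
      ∑ x ∈ Finset.univ.filter (fun x : G => x ^ m = 1), (V i).character x) :
    (∀ i, ∃ t : ℝ, r i = (t : ℂ)) ∧
    ((Finset.univ.filter (fun x : G => x ^ m = 1 ∧ (g * x) ^ m = 1)).card : ℂ)
      = (Fintype.card G : ℂ) * ∑ i, ((r i) ^ 2 / (V i).character 1) * (V i).character g := by
  classical
  have hG : (Fintype.card G : ℂ) ≠ 0 := Nat.cast_ne_zero.2 Fintype.card_ne_zero
  let S := Finset.univ.filter (fun x : G => x ^ m = 1)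
  have hSinv : ∀ f : G → ℂ, ∑ x ∈ S, f x⁻¹ = ∑ x ∈ S, f x := fun f =>
    Finset.sum_bij' (fun x _ => x⁻¹) (fun x _ => x⁻¹) (by simp [S]) (by simp [S])
      (by simp) (by simp) (by simp)
  refine ⟨fun i => ?_, ?_⟩
  · refine ⟨(r i).re, ((Complex.conj_eq_iff_re).1 ?_).symm⟩
    rw [hr i, map_mul, map_sum]
    congr 1
    · simp
    · rw [← hSinv]
      refine Finset.sum_congr rfl fun x _ => ?_
      rw [aux_char_inv]
      simp
  have hcol := aux_col V hsimple hdistinct hcomplete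
  have hT : ∀ i, (V i).character 1 ≠ 0 ∧ ∑ x ∈ S, (V i).ρ x =
      ((Fintype.card G : ℂ) * r i / (V i).character 1) • (1 : V i →ₗ[ℂ] V i) := by
    intro i
    have := hsimple i
    have := aux_schur (V i) (∑ x ∈ S, (V i).ρ x) ?_
    · have ht : LinearMap.trace ℂ (V i) (∑ x ∈ S, (V i).ρ x) = (Fintype.card G : ℂ) * r i := by
        rw [map_sum, hr i, one_div, mul_inv_cancel_left₀ hG]
        rfl
      rwa [ht] at this
    · intro h
      rw [Finset.mul_sum, Finset.sum_mul]
      refine Finset.sum_bij' (fun x _ => h * x * h⁻¹) (fun x _ => h⁻¹ * x * h) ?_ ?_ ?_ ?_ ?_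
      · intro x hx
        simp only [S, Finset.mem_filter, Finset.mem_univ, true_and] at hx ⊢
        rw [conj_pow, hx]; simp
      · intro x hx
        simp only [S, Finset.mem_filter, Finset.mem_univ, true_and] at hx ⊢
        have := conj_pow (a := h⁻¹) (b := x) (i := m)
        rw [inv_inv] at this
        rw [this, hx]; simp
      · intro x _; group
      · intro x _; group
      · intro x _
        rw [← map_mul, ← map_mul]; congr 1; group
  have hsum : ∀ i, ∑ x ∈ S, ∑ y ∈ S, (V i).character (x * y * g) =
      ((Fintype.card G : ℂ) * r i / (V i).character 1) ^ 2 * (V i).character g := by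
    intro i
    have h1 : ∑ x ∈ S, ∑ y ∈ S, (V i).ρ (x * y * g) =
        (((Fintype.card G : ℂ) * r i / (V i).character 1) ^ 2) • (V i).ρ g := by
      calc _ = (∑ x ∈ S, (V i).ρ x) * (∑ x ∈ S, (V i).ρ x) * (V i).ρ g := by
            rw [Finset.sum_mul_sum, Finset.sum_mul]
            refine Finset.sum_congr rfl fun x _ => ?_
            rw [Finset.sum_mul]
            simp only [map_mul]
        _ = _ := by
            rw [(hT i).2, smul_mul_smul_comm, mul_one, smul_mul_assoc, one_mul, sq]
    have h2 := congrArg (LinearMap.trace ℂ (V i)) h1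
    simp only [map_sum, map_smul, smul_eq_mul] at h2
    exact h2
  have hcount : ((Finset.univ.filter (fun x : G => x ^ m = 1 ∧ (g * x) ^ m = 1)).card : ℂ)
      = ∑ x ∈ S, ∑ y ∈ S, if x * y * g = 1 then (1 : ℂ) else 0 := by
    have h1 : ∀ x y : G, (x * y * g = 1) ↔ y = (g * x)⁻¹ := by
      intro x y
      constructor
      · intro h
        rw [eq_inv_iff_mul_eq_one, ← conj_eq_one_iff (a := x)]
        rw [← h]; group
      · rintro rfl
        group
    simp only [h1, Finset.sum_ite_eq', S, Finset.mem_filter, Finset.mem_univ, true_and, inv_pow,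
      inv_eq_one]
    rw [← Finset.sum_filter, Finset.filter_filter]
    simp
  have hstep : (Fintype.card G : ℂ) *
      ((Finset.univ.filter (fun x : G => x ^ m = 1 ∧ (g * x) ^ m = 1)).card : ℂ)
      = ∑ i, (V i).character 1 * (((Fintype.card G : ℂ) * r i / (V i).character 1) ^ 2 *
          (V i).character g) := by
    simp only [← hsum, hcount, Finset.mul_sum]
    rw [Finset.sum_comm (s := Finset.univ)]
    refine Finset.sum_congr rfl fun x _ => ?_
    rw [Finset.sum_comm (s := Finset.univ)]
    refine Finset.sum_congr rfl fun y _ => ?_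
    rw [hcol]
    simp
  apply mul_left_cancel₀ hG
  rw [hstep, Finset.mul_sum, Finset.mul_sum]
  refine Finset.sum_congr rfl fun i _ => ?_
  have := (hT i).1
  field_simp
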